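/- arXiv:1407.2216 — 5 statements merged into one kernel-verified Lean document; each statement's English description precedes it below -/
import Mathlib

section
/- Let B ⊆ A[t] be a ℚ-subalgebra of the polynomial algebra A[t] such that t ∈ B and such that the formal derivative d/dt maps B into B. Then B = ev(B)[t]; concretely, B equals the set of all polynomials p ∈ A[t] every one of whose coefficients lies in the ℚ-subalgebra ev(B) ⊆ A. -/
open Polynomial in
/-- A subalgebra containing `X` contains every polynomial whose coefficients, seen as constant
polynomials, lie in it. -/
theorem Subalgebra.mem_of_forall_C_coeff_mem {R A : Type*} [CommSemiring R] [CommSemiring A]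
    [Algebra R A] {B : Subalgebra R A[X]} (hX : X ∈ B) {p : A[X]}
    (hp : ∀ n, C (p.coeff n) ∈ B) : p ∈ B := by
  rw [p.as_sum_range_C_mul_X_pow]
  exact B.sum_mem fun n _ => B.mul_mem (hp n) (B.pow_mem hX n)

open Polynomial in
/-- A `ℚ`-subalgebra containing `X` and stable under the derivative contains all coefficients of
its elements, seen as constant polynomials. -/
theorem Subalgebra.C_coeff_mem_of_derivative_mem {A : Type*} [CommRing A] [Algebra ℚ A]
    {B : Subalgebra ℚ A[X]} (hX : X ∈ B) (hd : ∀ p ∈ B, derivative p ∈ B)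
    {p : A[X]} (hp : p ∈ B) (n : ℕ) : C (p.coeff n) ∈ B := by
  induction hN : p.natDegree using Nat.strong_induction_on generalizing p n with
  | _ N ih =>
    have succ_mem (m : ℕ) : C (p.coeff (m + 1)) ∈ B := by
      rcases Nat.eq_zero_or_pos p.natDegree with h0 | hpos
      · rw [coeff_eq_zero_of_natDegree_lt (by omega), C_0]
        exact B.zero_mem
      · have h := B.smul_mem
          (ih _ (hN ▸ natDegree_derivative_lt hpos.ne') (hd p hp) m rfl) ((m + 1 : ℚ)⁻¹)
        have hm : (m + 1 : ℚ) ≠ 0 := by positivity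
        have e : C ((derivative p).coeff m) = (m + 1 : ℚ) • C (p.coeff (m + 1)) := by
          rw [coeff_derivative, Algebra.smul_def, map_add, map_natCast, map_one, mul_comm]
          simp
        rwa [e, inv_smul_smul₀ hm] at h
    cases n with
    | succ m => exact succ_mem m
    | zero =>
      have hdiv : p.divX ∈ B :=
        B.mem_of_forall_C_coeff_mem hX fun m => by simpa only [coeff_divX] using succ_mem m
      rw [← sub_eq_of_eq_add' p.divX_mul_X_add.symm]
      exact B.sub_mem hp (B.mul_mem hdiv hX)

/-- Let `A` be a commutative `ℚ`-algebra and `B ⊆ A[t]` a `ℚ`-subalgebra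
of the polynomial algebra such that `t ∈ B` and the formal derivative `d/dt` maps `B` into
`B`. Then `B = ev(B)[t]`: a polynomial `p ∈ A[t]` lies in `B` if and only if every
coefficient of `p` lies in the `ℚ`-subalgebra `ev(B) ⊆ A`, where `ev : A[t] → A` is
evaluation at `t = 0`. -/
theorem statement_0 (A : Type*) [CommRing A] [Algebra ℚ A]
    (B : Subalgebra ℚ (Polynomial A))
    (ht : Polynomial.X ∈ B)
    (hd : ∀ p ∈ B, Polynomial.derivative p ∈ B) :
    ∀ p : Polynomial A, p ∈ B ↔
      ∀ n : ℕ, p.coeff n ∈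
        B.map ((Polynomial.aeval (0 : A)).restrictScalars ℚ) := by
  refine fun p => ⟨fun hp n => ?_, fun hp => B.mem_of_forall_C_coeff_mem ht fun n => ?_⟩
  · exact ⟨_, B.C_coeff_mem_of_derivative_mem ht hd hp n, by simp⟩
  · obtain ⟨q, hq, hqn⟩ := hp n
    have h : q.coeff 0 = p.coeff n := by
      simpa [Polynomial.coeff_zero_eq_aeval_zero] using hqn
    exact h ▸ B.C_coeff_mem_of_derivative_mem ht hd hq 0
end

section
/- The operator E maps 𝒜_{(i,j)} into 𝒜_{(i+2,j)}, the operator F maps 𝒜_{(i,j)} into 𝒜_{(i−2,j)}, and for every (i,j) and every P ∈ 𝒜_{(i,j)} one has (E∘F − F∘E)(P) = (i − g)·P = H(P). Consequently H∘E − E∘H = 2E and H∘F − F∘H = −2F, so that e ↦ E, f ↦ F, h ↦ H defines a ℚ-linear representation of the Lie algebra sl₂ on 𝒜. -/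
open MvPolynomial

/-- The index set `S_g` of pairs `(i,j)` of integers. -/
def Sg (g : ℕ) : Set (ℤ × ℤ) :=
  {p | 0 ≤ p.1 ∧ 0 ≤ p.2 ∧ p.2 ≤ 2 * (g : ℤ) - 2 ∧ p.1 ≤ p.2 + 2 ∧
    Even (p.1 + p.2) ∧ p ≠ (0, 0)}

/-- The variables of the polynomial algebra `𝒜`: one variable `x_{i,j}` for each
`(i,j) ∈ S_g`, plus one extra variable `y`. -/
abbrev JacVar (g : ℕ) := {p : ℤ × ℤ // p ∈ Sg g} ⊕ Unit

/-- The polynomial algebra `𝒜` over `ℚ`. -/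
abbrev JacA (g : ℕ) := MvPolynomial (JacVar g) ℚ

open Classical in
/-- The element `x_{i,j}` of `𝒜`, with the conventions `x_{0,0} = g` and `x_{i,j} = 0` for
`(i,j) ∉ S_g ∪ {(0,0)}`. -/
noncomputable def Xv (g : ℕ) (i j : ℤ) : JacA g :=
  if h : (i, j) ∈ Sg g then X (Sum.inl ⟨(i, j), h⟩)
  else if (i, j) = ((0 : ℤ), (0 : ℤ)) then C (g : ℚ) else 0

/-- The element `y` of `𝒜`. -/
noncomputable def Yv (g : ℕ) : JacA g := X (Sum.inr ())

/-- The bigrading: `x_{i,j}` has bidegree `(i,j)` and `y` has bidegree `(0,2)`. -/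
def wt (g : ℕ) : JacVar g → ℤ × ℤ
  | Sum.inl p => p.1
  | Sum.inr _ => (0, 2)

/-- The bihomogeneous component `𝒜_{(i,j)}`. -/
noncomputable def Acomp (g : ℕ) (i j : ℤ) : Submodule ℚ (JacA g) :=
  weightedHomogeneousSubmodule ℚ (wt g) (i, j)

/-- Binomial coefficient `binom(n,r)` for integers, equal to `0` unless `0 ≤ r ≤ n`. -/
def ibinom (n r : ℤ) : ℚ :=
  if 0 ≤ r ∧ r ≤ n then (n.toNat.choose r.toNat : ℚ) else 0

open Classical in
/-- The (finite) set `S_g` as a `Finset` of pairs of integers. -/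
noncomputable def SgFinset (g : ℕ) : Finset (ℤ × ℤ) :=
  ((Finset.Icc (0 : ℤ) (2 * (g : ℤ))) ×ˢ (Finset.Icc (0 : ℤ) (2 * (g : ℤ)))).filter
    (· ∈ Sg g)

open Classical in
/-- Partial derivative `∂x_{i,j}` (zero if `(i,j) ∉ S_g`). -/
noncomputable def pd (g : ℕ) (p : ℤ × ℤ) (P : JacA g) : JacA g :=
  if h : p ∈ Sg g then pderiv (Sum.inl ⟨p, h⟩) P else 0

/-- The operator `E`: multiplication by `x_{2,0}`. -/
noncomputable def Eop (g : ℕ) (P : JacA g) : JacA g := Xv g 2 0 * P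

/-- The differential operator `F`. -/
noncomputable def Fop (g : ℕ) (P : JacA g) : JacA g :=
  (1 / 2 : ℚ) • (∑ p ∈ SgFinset g, ∑ q ∈ SgFinset g,
      (Yv g * Xv g (p.1 - 1) (p.2 - 1) * Xv g (q.1 - 1) (q.2 - 1)
        - C (ibinom (p.1 + q.1 - 2) (p.1 - 1)) * Xv g (p.1 + q.1 - 2) (p.2 + q.2))
      * pd g p (pd g q P))
  + ∑ p ∈ SgFinset g, Xv g (p.1 - 2) p.2 * pd g p P

/-- Euler's identity for the weights obtained by applying an additive map to the degrees. -/
theorem sum_weight_smul_X_mul_pderiv {σ M R : Type*} [Fintype σ] [CommRing R] [AddCommMonoid M]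
    {w : σ → M} {n : M} {P : MvPolynomial σ R} (hP : P.IsWeightedHomogeneous w n) (φ : M →+ ℤ) :
    ∑ v, φ (w v) • (X v * pderiv v P) = φ n • P := by
  induction hP using IsWeightedHomogeneous.induction_on with
  | zero => simp
  | add p q hp hq ihp ihq =>
    simp_rw [map_add, mul_add, smul_add, Finset.sum_add_distrib, ihp, ihq]
  | monomial d r hd =>
    simp_rw [X_mul_pderiv_monomial, ← natCast_zsmul, smul_smul, ← Finset.sum_smul]
    rw [← hd, Finsupp.weight_eq_sum, map_sum]
    congr 1
    exact Finset.sum_congr rfl fun v _ => by simp [mul_comm]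

theorem ibinom_symm (n r : ℤ) : ibinom n (n - r) = ibinom n r := by
  unfold ibinom
  by_cases h : 0 ≤ r ∧ r ≤ n
  · rw [if_pos h, if_pos (by omega)]
    congr 1
    rw [← Nat.choose_symm (n := n.toNat) (k := r.toNat) (by omega)]
    congr 1
    omega
  · rw [if_neg h, if_neg (by omega)]

theorem ibinom_one_right {n : ℤ} (hn : 0 ≤ n) : ibinom n 1 = n := by
  obtain ⟨m, rfl⟩ := Int.eq_ofNat_of_zero_le hn
  unfold ibinom
  rcases m with _ | m
  · simp
  · rw [if_pos (by norm_num)]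
    simp

theorem mem_SgFinset {g : ℕ} {p : ℤ × ℤ} : p ∈ SgFinset g ↔ p ∈ Sg g := by
  simp only [SgFinset, Finset.mem_filter, Finset.mem_product, Finset.mem_Icc, and_iff_right_iff_imp]
  rintro ⟨h₁, h₂, h₃, h₄, -, -⟩
  omega

noncomputable instance (g : ℕ) : Fintype {p : ℤ × ℤ // p ∈ Sg g} :=
  Fintype.subtype (SgFinset g) fun _ => mem_SgFinset

theorem two_zero_mem_Sg {g : ℕ} (hg : 1 ≤ g) : ((2, 0) : ℤ × ℤ) ∈ Sg g :=
  ⟨by norm_num, by norm_num, by dsimp only; omega, by norm_num, by decide, by decide⟩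

theorem Xv_of_mem {g : ℕ} {p : ℤ × ℤ} (hp : p ∈ Sg g) :
    Xv g p.1 p.2 = X (Sum.inl ⟨p, hp⟩) :=
  dif_pos hp

theorem Xv_zero_zero (g : ℕ) : Xv g 0 0 = C (g : ℚ) := by
  simp [Xv, Sg]

theorem Xv_eq_zero_of_neg {g : ℕ} {i j : ℤ} (hj : j < 0) : Xv g i j = 0 := by
  unfold Xv
  rw [dif_neg fun h => not_lt.2 h.2.1 hj, if_neg fun h => hj.ne (Prod.ext_iff.1 h).2]

theorem isWeightedHomogeneous_Xv (g : ℕ) (i j : ℤ) :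
    (Xv g i j).IsWeightedHomogeneous (wt g) (i, j) := by
  unfold Xv
  split_ifs with h h₀
  · exact isWeightedHomogeneous_X ℚ (wt g) (Sum.inl ⟨(i, j), h⟩)
  · rw [h₀]
    exact isWeightedHomogeneous_C (wt g) (g : ℚ)
  · exact isWeightedHomogeneous_zero ℚ (wt g) _

theorem isWeightedHomogeneous_Yv (g : ℕ) : (Yv g).IsWeightedHomogeneous (wt g) (0, 2) :=
  isWeightedHomogeneous_X ℚ (wt g) (Sum.inr ())

theorem isWeightedHomogeneous_pd {g : ℕ} {n : ℤ × ℤ} {P : JacA g}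
    (hP : P.IsWeightedHomogeneous (wt g) n) (p : ℤ × ℤ) :
    (pd g p P).IsWeightedHomogeneous (wt g) (n - p) := by
  unfold pd
  split_ifs with h
  · exact hP.pderiv (sub_add_cancel n p)
  · exact isWeightedHomogeneous_zero ℚ (wt g) _

theorem pd_smul (g : ℕ) (p : ℤ × ℤ) (c : ℚ) (P : JacA g) : pd g p (c • P) = c • pd g p P := by
  unfold pd
  split_ifs <;> simp

theorem pd_add (g : ℕ) (p : ℤ × ℤ) (P Q : JacA g) : pd g p (P + Q) = pd g p P + pd g p Q := by
  unfold pd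
  split_ifs <;> simp

theorem pd_Eop {g : ℕ} (hg : 1 ≤ g) (p : ℤ × ℤ) (P : JacA g) :
    pd g p (Eop g P) = (if p = (2, 0) then P else 0) + Xv g 2 0 * pd g p P := by
  classical
  have h20 := two_zero_mem_Sg hg
  have hX : Xv g 2 0 = X (Sum.inl ⟨(2, 0), h20⟩) := dif_pos h20
  unfold pd Eop
  rw [hX]
  split_ifs with h hp hp
  · subst hp
    rw [pderiv_mul, pderiv_X_self, one_mul]
  · rw [pderiv_mul, pderiv_X_of_ne (by simpa using Ne.symm hp), zero_mul]
  · exact absurd (hp ▸ h20) h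
  · simp

theorem pd_pd_Eop {g : ℕ} (hg : 1 ≤ g) (p q : ℤ × ℤ) (P : JacA g) :
    pd g p (pd g q (Eop g P)) = (if q = (2, 0) then pd g p P else 0) +
      (if p = (2, 0) then pd g q P else 0) + Xv g 2 0 * pd g p (pd g q P) := by
  have h := pd_Eop hg p (pd g q P)
  rw [Eop] at h
  rw [pd_Eop hg q, pd_add, h, ← add_assoc]
  congr 2
  split_ifs
  · rfl
  · simpa using pd_smul g p 0 0

/-- The coefficient of `∂_p ∂_q` in twice the operator `F`. -/
noncomputable def quadCoeff (g : ℕ) (p q : ℤ × ℤ) : JacA g :=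
  Yv g * Xv g (p.1 - 1) (p.2 - 1) * Xv g (q.1 - 1) (q.2 - 1)
    - C (ibinom (p.1 + q.1 - 2) (p.1 - 1)) * Xv g (p.1 + q.1 - 2) (p.2 + q.2)

theorem Fop_eq (g : ℕ) (P : JacA g) :
    Fop g P = (1 / 2 : ℚ) •
      (∑ p ∈ SgFinset g, ∑ q ∈ SgFinset g, quadCoeff g p q * pd g p (pd g q P)) +
      ∑ p ∈ SgFinset g, Xv g (p.1 - 2) p.2 * pd g p P :=
  rfl

theorem quadCoeff_comm (g : ℕ) (p q : ℤ × ℤ) : quadCoeff g p q = quadCoeff g q p := by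
  unfold quadCoeff
  rw [← ibinom_symm (p.1 + q.1 - 2) (p.1 - 1), add_comm q.1 p.1, add_comm q.2 p.2,
    show p.1 + q.1 - 2 - (p.1 - 1) = q.1 - 1 by ring]
  ring

theorem quadCoeff_two_zero {g : ℕ} {q : ℤ × ℤ} (hq : q ∈ Sg g) :
    quadCoeff g (2, 0) q = -((q.1 : ℚ) • Xv g q.1 q.2) := by
  unfold quadCoeff
  dsimp only
  rw [Xv_eq_zero_of_neg (j := 0 - 1) (by norm_num), add_sub_cancel_left, zero_add,
    show (2 - 1 : ℤ) = 1 by norm_num, ibinom_one_right hq.1, ← smul_eq_C_mul]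
  ring

theorem isWeightedHomogeneous_quadCoeff (g : ℕ) (p q : ℤ × ℤ) :
    (quadCoeff g p q).IsWeightedHomogeneous (wt g) (p + q - (2, 0)) := by
  unfold quadCoeff
  refine IsWeightedHomogeneous.sub ?_ ?_
  · have h : p + q - (2, 0) = (0, 2) + (p.1 - 1, p.2 - 1) + (q.1 - 1, q.2 - 1) := by
      ext <;> simp <;> ring
    rw [h]
    exact ((isWeightedHomogeneous_Yv g).mul (isWeightedHomogeneous_Xv g _ _)).mul
      (isWeightedHomogeneous_Xv g _ _)
  · have h : p + q - (2, 0) = (p.1 + q.1 - 2, p.2 + q.2) := by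
      ext <;> simp
    rw [h]
    exact (isWeightedHomogeneous_Xv g _ _).C_mul _

theorem isWeightedHomogeneous_Fop {g : ℕ} {n : ℤ × ℤ} {P : JacA g}
    (hP : P.IsWeightedHomogeneous (wt g) n) :
    (Fop g P).IsWeightedHomogeneous (wt g) (n - (2, 0)) := by
  rw [Fop_eq, smul_eq_C_mul]
  refine IsWeightedHomogeneous.add (IsWeightedHomogeneous.C_mul ?_ _) ?_
  · refine IsWeightedHomogeneous.sum _ _ _ fun p _ => IsWeightedHomogeneous.sum _ _ _ fun q _ => ?_
    convert (isWeightedHomogeneous_quadCoeff g p q).mul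
      (isWeightedHomogeneous_pd (isWeightedHomogeneous_pd hP q) p) using 1
    abel
  · refine IsWeightedHomogeneous.sum _ _ _ fun p _ => ?_
    convert (isWeightedHomogeneous_Xv g (p.1 - 2) p.2).mul (isWeightedHomogeneous_pd hP p) using 1
    ext <;> simp

theorem Fop_smul (g : ℕ) (c : ℚ) (P : JacA g) : Fop g (c • P) = c • Fop g P := by
  simp only [Fop_eq, pd_smul, mul_smul_comm, ← Finset.smul_sum, smul_add, smul_comm c]

theorem sum_fst_smul_Xv_mul_pd {g : ℕ} {n : ℤ × ℤ} {P : JacA g}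
    (hP : P.IsWeightedHomogeneous (wt g) n) :
    ∑ q ∈ SgFinset g, ((q.1 : ℚ) • Xv g q.1 q.2) * pd g q P = (n.1 : ℚ) • P := by
  have h := sum_weight_smul_X_mul_pderiv hP (AddMonoidHom.fst ℤ ℤ)
  rw [Fintype.sum_sum_type] at h
  simp only [wt, AddMonoidHom.coe_fst, zero_smul, Finset.sum_const_zero, add_zero] at h
  rw [Int.cast_smul_eq_zsmul, ← h,
    Finset.sum_subtype (SgFinset g) (p := (· ∈ Sg g)) fun _ => mem_SgFinset]
  refine Finset.sum_congr rfl fun q _ => ?_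
  rw [Xv_of_mem q.2, pd, dif_pos q.2, Int.cast_smul_eq_zsmul, smul_mul_assoc]

theorem Fop_Eop {g : ℕ} (hg : 1 ≤ g) (P : JacA g) :
    Fop g (Eop g P) = Eop g (Fop g P) + (g : ℚ) • P -
      ∑ q ∈ SgFinset g, ((q.1 : ℚ) • Xv g q.1 q.2) * pd g q P := by
  have h20 : ((2, 0) : ℤ × ℤ) ∈ SgFinset g := mem_SgFinset.2 (two_zero_mem_Sg hg)
  have hquad : ∑ q ∈ SgFinset g, quadCoeff g (2, 0) q * pd g q P =
      -∑ q ∈ SgFinset g, ((q.1 : ℚ) • Xv g q.1 q.2) * pd g q P := by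
    rw [← Finset.sum_neg_distrib]
    exact Finset.sum_congr rfl fun q hq => by
      rw [quadCoeff_two_zero (mem_SgFinset.1 hq), neg_mul]
  have hquad' : ∑ q ∈ SgFinset g, quadCoeff g q (2, 0) * pd g q P =
      -∑ q ∈ SgFinset g, ((q.1 : ℚ) • Xv g q.1 q.2) * pd g q P := by
    simp_rw [← hquad, quadCoeff_comm g (2, 0)]
  have hsecond : ∑ p ∈ SgFinset g, ∑ q ∈ SgFinset g,
      quadCoeff g p q * pd g p (pd g q (Eop g P)) =
      (-2 : ℚ) • ∑ q ∈ SgFinset g, ((q.1 : ℚ) • Xv g q.1 q.2) * pd g q P +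
      Xv g 2 0 * ∑ p ∈ SgFinset g, ∑ q ∈ SgFinset g, quadCoeff g p q * pd g p (pd g q P) := by
    simp only [pd_pd_Eop hg, mul_add, Finset.sum_add_distrib, mul_ite, mul_zero,
      Finset.sum_ite_eq', h20, if_true]
    rw [hquad', Finset.sum_comm (f := fun p q => if p = (2, 0) then _ else _)]
    simp only [Finset.sum_ite_eq', h20, if_true, hquad, Finset.mul_sum, mul_left_comm (Xv g 2 0)]
    module
  have hfirst : ∑ p ∈ SgFinset g, Xv g (p.1 - 2) p.2 * pd g p (Eop g P) =
      (g : ℚ) • P + Xv g 2 0 * ∑ p ∈ SgFinset g, Xv g (p.1 - 2) p.2 * pd g p P := by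
    simp only [pd_Eop hg, mul_add, Finset.sum_add_distrib, mul_ite, mul_zero,
      Finset.sum_ite_eq', h20, if_true, sub_self, Xv_zero_zero, ← smul_eq_C_mul, Finset.mul_sum,
      mul_left_comm (Xv g 2 0)]
  rw [Fop_eq g (Eop g P), hsecond, hfirst, Eop, Fop_eq, mul_add, mul_smul_comm]
  module

/-- `E` maps `𝒜_{(i,j)}` into `𝒜_{(i+2,j)}`, `F` maps `𝒜_{(i,j)}` into
`𝒜_{(i−2,j)}`, on `𝒜_{(i,j)}` one has `[E,F] = (i−g)·id = H`, and the commutators of `H`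
(which acts on `𝒜_{(i,j)}` as `i−g`) with `E` and `F` are `2E` and `−2F` respectively,
so that `e ↦ E`, `f ↦ F`, `h ↦ H` is an `sl₂`-representation. -/
theorem statement_1 (g : ℕ) (hg : 1 ≤ g) (i j : ℤ) (P : JacA g) (hP : P ∈ Acomp g i j) :
    Eop g P ∈ Acomp g (i + 2) j ∧
    Fop g P ∈ Acomp g (i - 2) j ∧
    Eop g (Fop g P) - Fop g (Eop g P) = ((i : ℚ) - (g : ℚ)) • P ∧
    (((i : ℚ) + 2 - (g : ℚ)) • Eop g P - Eop g (((i : ℚ) - (g : ℚ)) • P)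
        = (2 : ℚ) • Eop g P) ∧
    (((i : ℚ) - 2 - (g : ℚ)) • Fop g P - Fop g (((i : ℚ) - (g : ℚ)) • P)
        = (-2 : ℚ) • Fop g P) := by
  have hP' : P.IsWeightedHomogeneous (wt g) (i, j) := hP
  refine ⟨?_, ?_, ?_, ?_, ?_⟩
  · show (Eop g P).IsWeightedHomogeneous (wt g) (i + 2, j)
    simpa [Eop, add_comm] using (isWeightedHomogeneous_Xv g 2 0).mul hP'
  · show (Fop g P).IsWeightedHomogeneous (wt g) (i - 2, j)
    simpa using isWeightedHomogeneous_Fop hP'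
  · rw [Fop_Eop hg, sum_fst_smul_Xv_mul_pd hP']
    module
  · simp only [Eop, mul_smul_comm]
    module
  · rw [Fop_smul]
    module
end

section
/- If i ≥ 0 satisfies 3i ≤ g (equivalently i ≤ ⌊g/3⌋), then every monomial of 𝒜 of bidegree (2g+2, 2i) is divisible by x_{2,0}. Equivalently, there is no monomial of bidegree (2g+2, 2i) in the variables {x_{a,b} : (a,b) ∈ S_g, (a,b) ≠ (2,0)} and y. -/
open MvPolynomial

/-- Every element of `S_g` other than `(2,0)` has slope at most three. -/
lemma fst_le_three_mul_snd_of_mem_Sg {g : ℕ} {p : ℤ × ℤ} (hp : p ∈ Sg g) (h : p ≠ (2, 0)) :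
    p.1 ≤ 3 * p.2 := by
  obtain ⟨a, b⟩ := p
  obtain ⟨h1, h2, -, h4, ⟨k, hk⟩, h6⟩ := hp
  simp only [ne_eq, Prod.mk.injEq] at h h6 h1 h2 h4 hk ⊢
  omega

/-- If `x_{2,0}` does not occur in a monomial, its bidegree has slope at most three. -/
lemma weight_fst_le_three_mul_snd {g : ℕ} (h20 : ((2, 0) : ℤ × ℤ) ∈ Sg g) (m : JacVar g →₀ ℕ)
    (h : m (Sum.inl ⟨(2, 0), h20⟩) = 0) :
    (Finsupp.weight (wt g) m).1 ≤ 3 * (Finsupp.weight (wt g) m).2 := by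
  rw [Finsupp.weight_apply, Finsupp.sum, Prod.fst_sum, Prod.snd_sum, Finset.mul_sum]
  refine Finset.sum_le_sum fun v hv => ?_
  have hw : (wt g v).1 ≤ 3 * (wt g v).2 := by
    rcases v with ⟨p, hp⟩ | u
    · refine fst_le_three_mul_snd_of_mem_Sg hp ?_
      rintro rfl
      exact Finsupp.mem_support_iff.mp hv h
    · simp [wt]
  simpa [mul_left_comm] using mul_le_mul_of_nonneg_left hw (Int.natCast_nonneg (m v))

/-- If `3i ≤ g`, then every monomial of `𝒜` of bidegree `(2g+2, 2i)` is
divisible by `x_{2,0}`. -/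
theorem statement_5 (g : ℕ) (hg : 1 ≤ g) (i : ℕ) (h3 : 3 * i ≤ g)
    (m : JacVar g →₀ ℕ)
    (hm : (monomial m (1 : ℚ)) ∈ Acomp g (2 * (g : ℤ) + 2) (2 * (i : ℤ))) :
    Xv g 2 0 ∣ (monomial m (1 : ℚ)) := by
  have h20 : ((2, 0) : ℤ × ℤ) ∈ Sg g :=
    ⟨by simp, by simp, by simp only; omega, by simp, by decide, by simp⟩
  have hw : Finsupp.weight (wt g) m = (2 * (g : ℤ) + 2, 2 * (i : ℤ)) :=
    hm (by simp)
  have hne : m (Sum.inl ⟨(2, 0), h20⟩) ≠ 0 := by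
    intro h
    have := weight_fst_le_three_mul_snd h20 m h
    rw [hw] at this
    simp only at this
    omega
  rw [Xv, dif_pos h20, X_dvd_monomial]
  exact Or.inr hne
end

section
/- Let n ≥ 1 be an integer and let β ∈ V satisfy h(β) = (n−1)·β and fⁿ(β) = 0. Then fⁿ(e(β)) = 0. -/
/-- The commutation relation `[e, f^(m+1)] = (m+1) f^m (h - m)` in a representation of `sl₂`,
applied to a vector. -/
theorem sl2_e_apply_f_pow_succ {R V : Type*} [CommRing R] [AddCommGroup V] [Module R V]
    {e f h : Module.End R V} (hef : e * f - f * e = h) (hhf : h * f - f * h = (-2 : R) • f)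
    (m : ℕ) (v : V) :
    e ((f ^ (m + 1)) v) =
      (f ^ (m + 1)) (e v) + ((m : R) + 1) • (f ^ m) (h v - (m : R) • v) := by
  have e_f (w : V) : e (f w) = f (e w) + h w := by
    simp [← hef]
  have h_f (w : V) : h (f w) = f (h w) - (2 : R) • f w := by
    have := LinearMap.congr_fun hhf w
    simp only [LinearMap.sub_apply, Module.End.mul_apply, LinearMap.smul_apply] at this
    rw [sub_eq_iff_eq_add.mp this]
    module
  induction m generalizing v with
  | zero => simp [e_f]
  | succ k ih =>
    have step (j : ℕ) (w : V) : (f ^ (j + 1)) w = (f ^ j) (f w) := by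
      rw [pow_succ, Module.End.mul_apply]
    rw [step (k + 1) v, ih (f v), e_f, h_f, step (k + 1) (e v)]
    simp only [map_add, map_sub, map_smul, step k (h v), step k v]
    push_cast
    module


/-- If `e, f, h` are `ℚ`-linear endomorphisms of a `ℚ`-vector space `V`
satisfying the `sl₂`-relations, `n ≥ 1`, and `β ∈ V` satisfies `h(β) = (n−1)·β` and
`fⁿ(β) = 0`, then `fⁿ(e(β)) = 0`. -/
theorem statement_9 (V : Type*) [AddCommGroup V] [Module ℚ V]
    (e f h : Module.End ℚ V)
    (hef : e * f - f * e = h)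
    (hhe : h * e - e * h = (2 : ℚ) • e)
    (hhf : h * f - f * h = (-2 : ℚ) • f)
    (n : ℕ) (hn : 1 ≤ n) (β : V)
    (hβ : h β = ((n : ℚ) - 1) • β)
    (hfn : (f ^ n) β = 0) :
    (f ^ n) (e β) = 0 := by
  obtain ⟨m, rfl⟩ := Nat.exists_eq_add_of_le' hn
  have weight : h β - (m : ℚ) • β = 0 := by
    rw [hβ]
    push_cast
    module
  have comm := sl2_e_apply_f_pow_succ hef hhf m β
  rw [hfn, weight] at comm
  simpa using comm.symm
end

section
/- Let D ≥ 0 and let T = ⊕_{i=0}^{D} T^i be a graded commutative ℚ-algebra with 1 ∈ T^0, T^i·T^j ⊆ T^{i+j}, T^i = 0 for i > D, each T^i finite-dimensional over ℚ, and dim_ℚ T^D = 1. Let m ≥ 0, let c₁, …, c_{m+1} be elements with c_k ∈ T^k, and let f = X^{m+1} + c₁X^m + ⋯ + c_{m+1} ∈ T[X]. Set R := T[X]/(f), graded by giving X degree 1 (f is homogeneous of degree m+1 for this grading, so R inherits a grading, and R is a free T-module with basis 1, X, …, X^m). Then: R^i = 0 for i > D + m, dim_ℚ R^{D+m} = 1,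 and the multiplication pairings R^i × R^{D+m−i} → R^{D+m} ≅ ℚ are perfect for all 0 ≤ i ≤ D+m if and only if the multiplication pairings T^i × T^{D−i} → T^D ≅ ℚ are perfect for all 0 ≤ i ≤ D. -/
open Polynomial

/-- Given a grading `𝒯` of `T`, the degree-`i` component of `T[X]` where `X` has
degree `1`: the polynomials `p` with `coeff n ∈ T^{i−n}` for `n ≤ i` and `coeff n = 0`
for `n > i`. -/
def Pgrade {T : Type*} [CommRing T] [Algebra ℚ T]
    (𝒯 : ℕ → Submodule ℚ T) (i : ℕ) : Submodule ℚ (Polynomial T) where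
  carrier := {p | ∀ n : ℕ, (n ≤ i → p.coeff n ∈ 𝒯 (i - n)) ∧ (i < n → p.coeff n = 0)}
  add_mem' := by
    intro p q hp hq n
    refine ⟨fun h => ?_, fun h => ?_⟩
    · simpa [coeff_add] using Submodule.add_mem _ ((hp n).1 h) ((hq n).1 h)
    · simp [coeff_add, (hp n).2 h, (hq n).2 h]
  zero_mem' := by
    intro n
    simp
  smul_mem' := by
    intro c p hp n
    refine ⟨fun h => ?_, fun h => ?_⟩
    · simpa [coeff_smul] using Submodule.smul_mem _ c ((hp n).1 h)
    · simp [coeff_smul, (hp n).2 h]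

/-- A graded algebra `R` with components `comp i`, vanishing above `t`, has *perfect
multiplication pairings with socle in degree `t`* if for every `ℚ`-linear functional `φ`
on `R` that is injective on the (one-dimensional) top component `comp t`, and every
`i ≤ t`, the two maps induced by `(x, y) ↦ φ (x * y)` from `comp i` to the dual of
`comp (t−i)` and from `comp (t−i)` to the dual of `comp i` are bijective. -/
def IsGorensteinAt (R : Type*) [CommRing R] [Algebra ℚ R]
    (comp : ℕ → Submodule ℚ R) (t : ℕ) : Prop :=
  ∀ φ : R →ₗ[ℚ] ℚ, (∀ z ∈ comp t, φ z = 0 → z = 0) →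
    ∀ i ≤ t,
      Function.Bijective (fun x : comp i =>
        (φ.comp (LinearMap.mulLeft ℚ (x : R))).comp (comp (t - i)).subtype) ∧
      Function.Bijective (fun y : comp (t - i) =>
        (φ.comp (LinearMap.mulLeft ℚ (y : R))).comp (comp i).subtype)

/-- The multiplication pairings of `comp i` with `comp (t - i)`, `i ≤ t`, have no kernel on
the left. -/
def HasNondegeneratePairings {R : Type*} [CommRing R] [Algebra ℚ R]
    (comp : ℕ → Submodule ℚ R) (t : ℕ) : Prop :=
  ∀ i ≤ t, ∀ x ∈ comp i, (∀ y ∈ comp (t - i), x * y = 0) → x = 0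

theorem bijective_pairing_of_separating {R : Type*} [CommRing R] [Algebra ℚ R]
    [Module.Finite ℚ R] (φ : R →ₗ[ℚ] ℚ) (U V : Submodule ℚ R)
    (hU : ∀ x ∈ U, (∀ y ∈ V, φ (x * y) = 0) → x = 0)
    (hV : ∀ y ∈ V, (∀ x ∈ U, φ (y * x) = 0) → y = 0) :
    Function.Bijective (fun x : U =>
      (φ.comp (LinearMap.mulLeft ℚ (x : R))).comp V.subtype) := by
  have key : ∀ U V : Submodule ℚ R, (∀ x ∈ U, (∀ y ∈ V, φ (x * y) = 0) → x = 0) →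
      ∃ L : U →ₗ[ℚ] Module.Dual ℚ V, Function.Injective L ∧
        ∀ x : U, L x = (φ.comp (LinearMap.mulLeft ℚ (x : R))).comp V.subtype := by
    intro U V hU
    refine ⟨((LinearMap.mul ℚ R).compr₂ φ).domRestrict₁₂ U V, ?_, fun x => rfl⟩
    refine (injective_iff_map_eq_zero _).2 fun x hx => Subtype.ext (hU x x.2 fun y hy => ?_)
    exact LinearMap.congr_fun hx ⟨y, hy⟩
  obtain ⟨L, hL, hLU⟩ := key U V hU
  obtain ⟨M, hM, -⟩ := key V U hV
  have h₁ := LinearMap.finrank_le_finrank_of_injective hL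
  have h₂ := LinearMap.finrank_le_finrank_of_injective hM
  rw [Subspace.dual_finrank_eq] at h₁ h₂
  have hdim : Module.finrank ℚ U = Module.finrank ℚ (Module.Dual ℚ V) := by
    rw [Subspace.dual_finrank_eq]; exact le_antisymm h₁ h₂
  rw [← funext hLU]
  exact ⟨hL, (LinearMap.injective_iff_surjective_of_finrank_eq_finrank hdim).1 hL⟩

theorem isGorensteinAt_iff_hasNondegeneratePairings {R : Type*} [CommRing R] [Algebra ℚ R]
    [Module.Finite ℚ R] (comp : ℕ → Submodule ℚ R) (t : ℕ)
    (hmul : ∀ i ≤ t, ∀ x ∈ comp i, ∀ y ∈ comp (t - i), x * y ∈ comp t)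
    (ht : Module.finrank ℚ (comp t) = 1) :
    IsGorensteinAt R comp t ↔ HasNondegeneratePairings comp t := by
  constructor
  · intro h i hi x hx hxy
    obtain ⟨φ, hφ⟩ := LinearMap.exists_extend
      (LinearEquiv.ofFinrankEq (comp t) ℚ (by simp [ht])).toLinearMap
    have hφ' : ∀ z ∈ comp t, φ z = 0 → z = 0 := fun z hz hz0 => by
      have := (LinearMap.congr_fun hφ ⟨z, hz⟩).symm.trans hz0
      simpa only [Submodule.mk_eq_zero] using (LinearEquiv.map_eq_zero_iff _).1 this
    have := (h φ hφ' i hi).1.injective (a₁ := ⟨x, hx⟩) (a₂ := 0)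
      (by ext y; simp [hxy y y.2])
    simpa using this
  · intro h φ hφ i hi
    have hl : ∀ x ∈ comp i, (∀ y ∈ comp (t - i), φ (x * y) = 0) → x = 0 := fun x hx hxy =>
      h i hi x hx fun y hy => hφ _ (hmul i hi x hx y hy) (hxy y hy)
    have hr : ∀ y ∈ comp (t - i), (∀ x ∈ comp i, φ (y * x) = 0) → y = 0 := fun y hy hyx =>
      h (t - i) (Nat.sub_le t i) y hy fun x hx => by
        rw [Nat.sub_sub_self hi] at hx
        refine hφ _ ?_ (hyx x hx)
        rw [mul_comm]
        exact hmul i hi x hx y hy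
    exact ⟨bijective_pairing_of_separating φ _ _ hl hr,
      bijective_pairing_of_separating φ _ _ hr hl⟩

theorem finite_of_graded_of_eventually_bot {T : Type*} [CommRing T] [Algebra ℚ T]
    (𝒯 : ℕ → Submodule ℚ T) [GradedAlgebra 𝒯] (D : ℕ) (htop : ∀ i, D < i → 𝒯 i = ⊥)
    (hfin : ∀ i, FiniteDimensional ℚ (𝒯 i)) : Module.Finite ℚ T := by
  have h : (⨆ i : Fin (D + 1), 𝒯 i) = ⊤ := by
    rw [eq_top_iff, ← (DirectSum.Decomposition.isInternal 𝒯).submodule_iSup_eq_top]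
    refine iSup_le fun i => ?_
    rcases Nat.lt_or_ge D i with hi | hi
    · simp [htop i hi]
    · exact le_iSup (fun i : Fin (D + 1) => 𝒯 i) ⟨i, Nat.lt_succ_of_le hi⟩
  have : Module.Finite ℚ (⨆ i : Fin (D + 1), 𝒯 i : Submodule ℚ T) := inferInstance
  rw [h] at this
  exact Module.Finite.of_surjective (⊤ : Submodule ℚ T).subtype fun x => ⟨⟨x, trivial⟩, rfl⟩

section Pgrade

variable {T : Type*} [CommRing T] [Algebra ℚ T] (𝒯 : ℕ → Submodule ℚ T)

theorem C_mul_X_pow_mem_Pgrade {j : ℕ} {a : T} (ha : a ∈ 𝒯 j) (n : ℕ) :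
    C a * X ^ n ∈ Pgrade 𝒯 (j + n) := by
  intro k
  rw [coeff_C_mul_X_pow]
  refine ⟨fun _ => ?_, fun h => if_neg (by omega)⟩
  split_ifs with h
  · rwa [h, Nat.add_sub_cancel]
  · exact zero_mem _

theorem mul_mem_Pgrade [GradedAlgebra 𝒯] {i j : ℕ} {p q : T[X]} (hp : p ∈ Pgrade 𝒯 i)
    (hq : q ∈ Pgrade 𝒯 j) : p * q ∈ Pgrade 𝒯 (i + j) := by
  intro n
  rw [coeff_mul]
  constructor
  · intro hn
    refine Submodule.sum_mem _ fun x hx => ?_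
    rw [Finset.HasAntidiagonal.mem_antidiagonal] at hx
    rcases Nat.lt_or_ge i x.1 with h₁ | h₁
    · simp [(hp x.1).2 h₁]
    rcases Nat.lt_or_ge j x.2 with h₂ | h₂
    · simp [(hq x.2).2 h₂]
    have := SetLike.mul_mem_graded ((hp x.1).1 h₁) ((hq x.2).1 h₂)
    rwa [show i - x.1 + (j - x.2) = i + j - n by omega] at this
  · intro hn
    refine Finset.sum_eq_zero fun x hx => ?_
    rw [Finset.HasAntidiagonal.mem_antidiagonal] at hx
    rcases Nat.lt_or_ge i x.1 with h₁ | h₁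
    · simp [(hp x.1).2 h₁]
    · simp [(hq x.2).2 (by omega)]

theorem coeff_eq_zero_of_mem_Pgrade {D : ℕ} (htop : ∀ i, D < i → 𝒯 i = ⊥) {i n : ℕ}
    {p : T[X]} (hp : p ∈ Pgrade 𝒯 i) (hn : D + n < i) : p.coeff n = 0 := by
  have := (hp n).1 (by omega)
  rwa [htop _ (by omega), Submodule.mem_bot] at this

theorem exists_mem_Pgrade_degree_lt [Nontrivial T] [GradedAlgebra 𝒯] {f : T[X]} (hf : f.Monic)
    (hfg : f ∈ Pgrade 𝒯 f.natDegree) {i : ℕ} (p : T[X]) (hp : p ∈ Pgrade 𝒯 i) :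
    ∃ q ∈ Pgrade 𝒯 i, q.degree < f.degree ∧
      Ideal.Quotient.mk (Ideal.span {f}) q = Ideal.Quotient.mk (Ideal.span {f}) p := by
  induction p using Polynomial.degree_lt_wf.induction with
  | _ p ih =>
    rcases lt_or_ge p.degree f.degree with h | h
    · exact ⟨p, hp, h, rfl⟩
    by_cases hp0 : p = 0
    · rw [hp0, degree_zero, le_bot_iff, degree_eq_bot] at h
      exact absurd h hf.ne_zero
    have hdeg : f.natDegree ≤ p.natDegree := natDegree_le_natDegree h
    have hpi : p.natDegree ≤ i := by
      by_contra hlt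
      exact hp0 (leadingCoeff_eq_zero.1 ((hp p.natDegree).2 (by omega)))
    have hmem := mul_mem_Pgrade 𝒯 hfg (C_mul_X_pow_mem_Pgrade 𝒯 ((hp p.natDegree).1 hpi)
      (p.natDegree - f.natDegree))
    rw [show f.natDegree + (i - p.natDegree + (p.natDegree - f.natDegree)) = i by omega] at hmem
    obtain ⟨q, hq, hqd, hqp⟩ := ih _ (div_wf_lemma ⟨h, hp0⟩ hf) (Submodule.sub_mem _ hp hmem)
    refine ⟨q, hq, hqd, hqp.trans ?_⟩
    rw [Ideal.Quotient.eq, Ideal.mem_span_singleton]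
    simp

end Pgrade

theorem Polynomial.Monic.eq_zero_of_mk_eq_zero {T : Type*} [CommRing T] {f p : T[X]}
    (hf : f.Monic) (hp : p.degree < f.degree)
    (h : Ideal.Quotient.mk (Ideal.span {f}) p = 0) : p = 0 := by
  rw [Ideal.Quotient.eq_zero_iff_mem, Ideal.mem_span_singleton] at h
  by_contra hp0
  exact hf.not_dvd_of_degree_lt hp0 hp h

/-- Let `T = ⊕_{i=0}^D T^i` be a graded commutative `ℚ`-algebra with
finite-dimensional components, `T^i = 0` for `i > D` and `dim T^D = 1`. Let
`f = X^{m+1} + c₁X^m + ⋯ + c_{m+1} ∈ T[X]` with `c_k ∈ T^k`, and let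
`R = T[X]/(f)`, graded with `X` in degree `1`. Then `R^i = 0` for `i > D + m`,
`dim R^{D+m} = 1`, and the multiplication pairings
`R^i × R^{D+m−i} → R^{D+m} ≅ ℚ` are perfect for all `0 ≤ i ≤ D + m` if and only if the
pairings `T^i × T^{D−i} → T^D ≅ ℚ` are perfect for all `0 ≤ i ≤ D`. -/
theorem statement_11 (D m : ℕ) (T : Type*) [CommRing T] [Algebra ℚ T]
    (𝒯 : ℕ → Submodule ℚ T) [GradedAlgebra 𝒯]
    (htop : ∀ i, D < i → 𝒯 i = ⊥)
    (hfin : ∀ i, FiniteDimensional ℚ (𝒯 i))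
    (hD : Module.finrank ℚ (𝒯 D) = 1)
    (c : ℕ → T) (hc : ∀ k, 1 ≤ k → k ≤ m + 1 → c k ∈ 𝒯 k)
    (f : Polynomial T)
    (hf : f = Polynomial.X ^ (m + 1) +
      ∑ k ∈ Finset.Icc 1 (m + 1), Polynomial.C (c k) * Polynomial.X ^ (m + 1 - k))
    (Rcomp : ℕ → Submodule ℚ (Polynomial T ⧸ Ideal.span {f}))
    (hR : ∀ i, Rcomp i =
      (Pgrade 𝒯 i).map (Ideal.Quotient.mkₐ ℚ (Ideal.span {f})).toLinearMap) :
    (∀ i, D + m < i → Rcomp i = ⊥) ∧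
    Module.finrank ℚ (Rcomp (D + m)) = 1 ∧
    (IsGorensteinAt (Polynomial T ⧸ Ideal.span {f}) Rcomp (D + m) ↔
      IsGorensteinAt T 𝒯 D) := by
  have hnt : Nontrivial T := by
    have : Nontrivial (𝒯 D) := Module.nontrivial_of_finrank_pos (R := ℚ) (by omega)
    exact (𝒯 D).subtype_injective.nontrivial
  have hTfin := finite_of_graded_of_eventually_bot 𝒯 D htop hfin
  have hlow : (∑ k ∈ Finset.Icc 1 (m + 1), C (c k) * X ^ (m + 1 - k)).degree <
      ((m + 1 : ℕ) : WithBot ℕ) := by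
    refine (degree_sum_le _ _).trans_lt ((Finset.sup_lt_iff (WithBot.bot_lt_coe _)).2 ?_)
    intro k hk
    rw [Finset.mem_Icc] at hk
    exact (degree_C_mul_X_pow_le _ _).trans_lt (Nat.cast_lt.2 (by omega))
  have hmonic : f.Monic := hf ▸ monic_X_pow_add hlow
  have hdeg : f.degree = (m + 1 : ℕ) := by
    rw [hf, degree_add_eq_left_of_degree_lt] <;> rw [degree_X_pow]
    exact hlow
  have hfg : f ∈ Pgrade 𝒯 f.natDegree := by
    rw [natDegree_eq_of_degree_eq_some hdeg, hf]
    refine Submodule.add_mem _ ?_ (Submodule.sum_mem _ fun k hk => ?_)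
    · simpa using C_mul_X_pow_mem_Pgrade 𝒯 (SetLike.one_mem_graded 𝒯) (m + 1)
    · rw [Finset.mem_Icc] at hk
      have := C_mul_X_pow_mem_Pgrade 𝒯 (hc k hk.1 hk.2) (m + 1 - k)
      rwa [Nat.add_sub_cancel' hk.2] at this
  have hmk : ∀ {i p}, p ∈ Pgrade 𝒯 i → Ideal.Quotient.mk (Ideal.span {f}) p ∈ Rcomp i :=
    fun {i p} hp => hR i ▸ ⟨p, hp, rfl⟩
  have hrep : ∀ i, ∀ x ∈ Rcomp i, ∃ q ∈ Pgrade 𝒯 i, q.degree < (m + 1 : ℕ) ∧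
      Ideal.Quotient.mk (Ideal.span {f}) q = x := by
    intro i x hx
    rw [hR] at hx
    obtain ⟨p, hp, rfl⟩ := hx
    obtain ⟨q, hq, hqd, hqp⟩ := exists_mem_Pgrade_degree_lt 𝒯 hmonic hfg p hp
    exact ⟨q, hq, hdeg ▸ hqd, hqp⟩
  have hzero : ∀ p : T[X], p.degree < (m + 1 : ℕ) →
      Ideal.Quotient.mk (Ideal.span {f}) p = 0 → p = 0 := fun p hp =>
    hmonic.eq_zero_of_mk_eq_zero (hdeg ▸ hp)
  have htopform : ∀ q ∈ Pgrade 𝒯 (D + m), q.degree < (m + 1 : ℕ) →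
      q = C (q.coeff m) * X ^ m := by
    intro q hq hqd
    ext n
    rw [coeff_C_mul_X_pow]
    split_ifs with h
    · rw [h]
    · rcases Nat.lt_or_ge n m with hn | hn
      · exact coeff_eq_zero_of_mem_Pgrade 𝒯 htop hq (by omega)
      · exact coeff_eq_zero_of_degree_lt (hqd.trans_le (Nat.cast_le.2 (by omega)))
  have hmonomial : ∀ a : T, ∀ n ≤ m, (C a * X ^ n).degree < ((m + 1 : ℕ) : WithBot ℕ) :=
    fun a n hn => (degree_C_mul_X_pow_le _ _).trans_lt (Nat.cast_lt.2 (by omega))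
  have hvanish : ∀ i, D + m < i → Rcomp i = ⊥ := by
    intro i hi
    rw [eq_bot_iff]
    intro x hx
    obtain ⟨q, hq, hqd, rfl⟩ := hrep i x hx
    have : q = 0 := by
      ext n
      rcases Nat.lt_or_ge m n with hn | hn
      · exact coeff_eq_zero_of_degree_lt (hqd.trans_le (Nat.cast_le.2 (by omega)))
      · exact coeff_eq_zero_of_mem_Pgrade 𝒯 htop hq (by omega)
    simp [this]
  have hrank : Module.finrank ℚ (Rcomp (D + m)) = 1 := by
    let L : T →ₗ[ℚ] T[X] ⧸ Ideal.span {f} :=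
      (Ideal.Quotient.mkₐ ℚ (Ideal.span {f})).toLinearMap.comp
        ((monomial m).restrictScalars ℚ)
    have hL : ∀ a, L a = Ideal.Quotient.mk (Ideal.span {f}) (C a * X ^ m) := fun a => by
      rw [C_mul_X_pow_eq_monomial]; rfl
    have hinj : Function.Injective L := by
      refine (injective_iff_map_eq_zero L).2 fun a ha => ?_
      have := hzero _ (hmonomial a m le_rfl) (hL a ▸ ha)
      simpa using congrArg (fun p => coeff p m) this
    have hmap : Rcomp (D + m) = (𝒯 D).map L := by
      ext x
      constructor
      · intro hx
        obtain ⟨q, hq, hqd, rfl⟩ := hrep _ x hx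
        refine ⟨q.coeff m, ?_, ?_⟩
        · simpa using (hq m).1 (by omega)
        · rw [hL, ← htopform q hq hqd]
      · rintro ⟨a, ha, rfl⟩
        rw [hL]
        exact hmk (C_mul_X_pow_mem_Pgrade 𝒯 ha m)
    rw [hmap, ← hD]
    exact (Submodule.equivMapOfInjective L hinj (𝒯 D)).finrank_eq.symm
  have hRfin : Module.Finite ℚ (T[X] ⧸ Ideal.span {f}) := by
    have := hmonic.finite_quotient
    exact Module.Finite.trans T _
  refine ⟨hvanish, hrank, ?_⟩
  rw [isGorensteinAt_iff_hasNondegeneratePairings Rcomp (D + m) ?_ hrank,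
    isGorensteinAt_iff_hasNondegeneratePairings 𝒯 D ?_ hD]
  · constructor
    · intro h i hi a ha hab
      have haP : C a ∈ Pgrade 𝒯 i := by simpa using C_mul_X_pow_mem_Pgrade 𝒯 ha 0
      have hCa := h i (by omega) _ (hmk haP) fun y hy => by
        obtain ⟨q, hq, hqd, rfl⟩ := hrep _ y hy
        have hmem := mul_mem_Pgrade 𝒯 haP hq
        rw [show i + (D + m - i) = D + m by omega] at hmem
        have hq' := (hq m).1 (by omega)
        rw [show D + m - i - m = D - i by omega] at hq'
        have hlt : (C a * q).degree < (m + 1 : ℕ) := by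
          rw [← smul_eq_C_mul]
          exact (degree_smul_le a q).trans_lt hqd
        rw [← map_mul, htopform _ hmem hlt, coeff_C_mul, hab _ hq']
        simp
      simpa using hzero (C a) (by simpa using hmonomial a 0 (Nat.zero_le m)) hCa
    · intro h i hi x hx hxy
      obtain ⟨p, hp, hpd, rfl⟩ := hrep i x hx
      by_contra hne
      have hp0 : p ≠ 0 := by rintro rfl; simp at hne
      have hpm : p.natDegree < m + 1 := (natDegree_lt_iff_degree_lt hp0).2 hpd
      have hpi : p.natDegree ≤ i := by
        by_contra hlt
        exact hp0 (leadingCoeff_eq_zero.1 ((hp p.natDegree).2 (by omega)))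
      have hiD : i - p.natDegree ≤ D := by
        by_contra hlt
        exact hp0 (leadingCoeff_eq_zero.1 (coeff_eq_zero_of_mem_Pgrade 𝒯 htop hp (by omega)))
      refine hp0 (leadingCoeff_eq_zero.1
        (h _ hiD _ ((hp p.natDegree).1 hpi) fun b hb => ?_))
      have hb' := C_mul_X_pow_mem_Pgrade 𝒯 hb (m - p.natDegree)
      rw [show D - (i - p.natDegree) + (m - p.natDegree) = D + m - i by omega] at hb'
      have hprod := hxy _ (hmk hb')
      rw [← map_mul] at hprod
      have hsmall : (p * (C b * X ^ (m - p.natDegree))).degree < ((m + 1 : ℕ) : WithBot ℕ) := by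
        refine (degree_le_of_natDegree_le (natDegree_mul_le.trans
          (Nat.add_le_add_left (natDegree_C_mul_X_pow_le _ _) _))).trans_lt
          (Nat.cast_lt.2 (by omega))
      have hcoeff := congrArg (fun p => coeff p m) (hzero _ hsmall hprod)
      rw [← mul_assoc] at hcoeff
      simpa [coeff_mul_X_pow', show m - (m - p.natDegree) = p.natDegree by omega]
        using hcoeff
  · intro i hi x hx y hy
    have := SetLike.mul_mem_graded hx hy
    rwa [Nat.add_sub_cancel' hi] at this
  · intro i hi x hx y hy
    obtain ⟨p, hp, -, rfl⟩ := hrep i x hx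
    obtain ⟨q, hq, -, rfl⟩ := hrep _ y hy
    have := mul_mem_Pgrade 𝒯 hp hq
    rw [Nat.add_sub_cancel' hi] at this
    rw [← map_mul]
    exact hmk this
end
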